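/- arXiv:1112.1295 — 2 statements merged into one kernel-verified Lean document; each statement's English description precedes it below -/
import Mathlib

section
/- Let b(m, o, r) denote the number of 0-1-2-increasing trees of size m having exactly o leaves and exactly r pitchforks (with b(m, o, r) = 0 when o ≤ 0 or r < 0). Then for all integers m ≥ 1, o ≥ 1 and r ≥ 0, b(m+1, o, r) = r·b(m, o, r) + (o − r + 1)·b(m, o, r−1) + (r + 1)·b(m, o−1, r+1) + (m − 2o + 3 − r)·b(m, o−1, r). -/
/-- A 0-1-2-increasing tree of size `m`: vertices are `Fin m` (index `i`
represents label `i+1`, so index `0` is the root labelled `1`), encoded by a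
parent function `f` with `f i < i` for every non-root vertex `i`
(and `f 0 = 0` by convention), such that every vertex has at most 2 children. -/
abbrev IncTree (m : ℕ) : Type :=
  {f : Fin m → Fin m //
    (∀ i : Fin m, i.val = 0 → f i = i) ∧
    (∀ i : Fin m, i.val ≠ 0 → (f i).val < i.val) ∧
    (∀ j : Fin m, (Finset.univ.filter (fun i : Fin m => i.val ≠ 0 ∧ f i = j)).card ≤ 2)}

/-- The number of children of the vertex `j` in the tree `t`. -/
def numChildren {m : ℕ} (t : IncTree m) (j : Fin m) : ℕ :=
  (Finset.univ.filter (fun i : Fin m => i.val ≠ 0 ∧ t.val i = j)).card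

/-- `o t`: the number of leaves (outdegree-0 vertices) of `t`. -/
def numLeaves {m : ℕ} (t : IncTree m) : ℕ :=
  (Finset.univ.filter (fun j : Fin m => numChildren t j = 0)).card

/-- `r t`: the number of pitchforks of `t`, i.e. vertices with exactly one
child, that child being a leaf. -/
def numPitchforks {m : ℕ} (t : IncTree m) : ℕ :=
  (Finset.univ.filter (fun j : Fin m =>
    numChildren t j = 1 ∧
      ∀ i : Fin m, i.val ≠ 0 → t.val i = j → numChildren t i = 0)).card

/-- `b m o r`: the number of 0-1-2-increasing trees of size `m` with exactly
`o` leaves and `r` pitchforks (indexed by `o r : ℤ` so that out-of-range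
values give `0`). -/
def countByLeavesPitchforks (m : ℕ) (o r : ℤ) : ℕ :=
  (Finset.univ.filter
    (fun t : IncTree m => (numLeaves t : ℤ) = o ∧ (numPitchforks t : ℤ) = r)).card

open Finset in
theorem ins_aux {m : ℕ} (t : IncTree m) (v j : Fin m) :
    (univ.filter (fun i : Fin (m+1) => i.val ≠ 0 ∧
      (Fin.snoc (α := fun _ => Fin (m+1)) (fun i => (t.val i).castSucc) v.castSucc : Fin (m+1) → Fin (m+1)) i = j.castSucc)).card
      = numChildren t j + if v = j then 1 else 0 := by
  have hm : m ≠ 0 := by have := v.isLt; omega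
  unfold numChildren
  rw [card_filter, card_filter, Fin.sum_univ_castSucc]
  simp [Fin.snoc_castSucc, Fin.snoc_last, Fin.castSucc_inj, hm]

open Finset in
theorem ins_aux_last {m : ℕ} (t : IncTree m) (v : Fin m) :
    (univ.filter (fun i : Fin (m+1) => i.val ≠ 0 ∧
      (Fin.snoc (α := fun _ => Fin (m+1)) (fun i => (t.val i).castSucc) v.castSucc : Fin (m+1) → Fin (m+1)) i = Fin.last m)).card
      = 0 := by
  rw [card_filter, Fin.sum_univ_castSucc]
  simp [Fin.snoc_castSucc, Fin.snoc_last, Fin.castSucc_ne_last]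

def ins {m : ℕ} (t : IncTree m) (v : Fin m) (h : numChildren t v < 2) : IncTree (m+1) :=
  ⟨Fin.snoc (α := fun _ => Fin (m+1)) (fun i => (t.val i).castSucc) v.castSucc, by
    have hm : m ≠ 0 := by have := v.isLt; omega
    refine ⟨?_, ?_, ?_⟩
    · intro i
      refine Fin.lastCases ?_ (fun i => ?_) i
      · intro h; simp at h; omega
      · intro h
        rw [Fin.snoc_castSucc, t.2.1 i (by simpa using h)]
    · intro i
      refine Fin.lastCases ?_ (fun i => ?_) i
      · intro h; simp
      · intro h
        rw [Fin.snoc_castSucc]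
        simpa using t.2.2.1 i (by simpa using h)
    · intro j
      refine Fin.lastCases ?_ (fun j => ?_) j
      · rw [ins_aux_last]; omega
      · rw [ins_aux]
        have := t.2.2.2 j
        change numChildren t j ≤ 2 at this
        split_ifs with hj
        · subst hj; omega
        · omega⟩

theorem nc_ins {m : ℕ} (t : IncTree m) (v : Fin m) (h) (j : Fin m) :
    numChildren (ins t v h) j.castSucc = numChildren t j + if v = j then 1 else 0 := ins_aux t v j

theorem nc_ins_last {m : ℕ} (t : IncTree m) (v : Fin m) (h) :
    numChildren (ins t v h) (Fin.last m) = 0 := ins_aux_last t v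

theorem ins_val_castSucc {m : ℕ} (t : IncTree m) (v : Fin m) (h) (j : Fin m) :
    (ins t v h).val j.castSucc = (t.val j).castSucc := by
  simp [ins]

theorem ins_val_last {m : ℕ} (t : IncTree m) (v : Fin m) (h) :
    (ins t v h).val (Fin.last m) = v.castSucc := by
  simp [ins]

def pf {m : ℕ} (t : IncTree m) (j : Fin m) : Prop :=
  numChildren t j = 1 ∧ ∀ i : Fin m, i.val ≠ 0 → t.val i = j → numChildren t i = 0

instance {m : ℕ} (t : IncTree m) (j : Fin m) : Decidable (pf t j) := by
  unfold pf; infer_instance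

theorem numPF_eq {m : ℕ} (t : IncTree m) :
    numPitchforks t = (Finset.univ.filter (fun j => pf t j)).card := rfl

open Finset in
theorem leaves_ins {m : ℕ} (t : IncTree m) (v : Fin m) (h) :
    numLeaves (ins t v h) + (if numChildren t v = 0 then 1 else 0) = numLeaves t + 1 := by
  unfold numLeaves
  rw [card_filter, card_filter, Fin.sum_univ_castSucc, nc_ins_last]
  simp only [nc_ins, if_true]
  rw [add_right_comm]
  congr 1
  rw [← Finset.add_sum_erase univ _ (mem_univ v), ← Finset.add_sum_erase univ (fun j => if numChildren t j = 0 then 1 else 0) (mem_univ v)]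
  have : ∀ x ∈ univ.erase v, (if (numChildren t x + if v = x then 1 else 0) = 0 then 1 else 0) = (if numChildren t x = 0 then 1 else 0) := by
    intro x hx
    have : v ≠ x := fun e => by simp [e] at hx
    simp [this]
  rw [sum_congr rfl this]
  simp
  ring

theorem pf_ins_last {m : ℕ} (t : IncTree m) (v : Fin m) (h) : ¬ pf (ins t v h) (Fin.last m) := by
  intro hp
  have := hp.1
  rw [nc_ins_last] at this
  omega

theorem nc_zero_iff {m : ℕ} (t : IncTree m) (j : Fin m) :
    numChildren t j = 0 ↔ ∀ i : Fin m, i.val ≠ 0 → t.val i ≠ j := by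
  unfold numChildren
  simp [Finset.filter_eq_empty_iff]

theorem pf_ins {m : ℕ} (t : IncTree m) (v : Fin m) (h) (j : Fin m) :
    pf (ins t v h) j.castSucc ↔ 
      (j = v ∧ numChildren t v = 0) ∨ (j ≠ v ∧ pf t j ∧ ¬ (v.val ≠ 0 ∧ t.val v = j)) := by
  have hm : m ≠ 0 := by have := v.isLt; omega
  unfold pf
  rw [Fin.forall_fin_succ']
  simp only [nc_ins, nc_ins_last, ins_val_castSucc, ins_val_last, Fin.castSucc_inj, Fin.val_castSucc]
  by_cases hj : j = v
  · subst hj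
    simp only [if_true, true_and, ne_eq, not_true_eq_false, false_and, or_false]
    constructor
    · intro h; omega
    · intro h
      refine ⟨by omega, fun i hi hij => ?_, by simp⟩
      exact absurd hij ((nc_zero_iff t j).1 h i hi)
  · have hj' : ¬ v = j := fun e => hj e.symm
    simp only [hj, hj', if_false, false_and, false_or, ne_eq, not_false_eq_true, true_and, add_zero, and_assoc]
    refine and_congr_right fun _ => ?_
    constructor
    · rintro ⟨h1, -⟩
      refine ⟨fun i hi hij => ?_, fun hv => ?_⟩
      · have := h1 i hi hij; omega
      · have := h1 v hv.1 hv.2; simp at this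
    · rintro ⟨h1, h2⟩
      refine ⟨fun i hi hij => ?_, by simp⟩
      have hiv : ¬ v = i := by rintro rfl; exact h2 ⟨hi, hij⟩
      simp [hiv, h1 i hi hij]

open Finset in
theorem numPF_ins {m : ℕ} (t : IncTree m) (v : Fin m) (h) :
    numPitchforks (ins t v h) = (univ.filter (fun j => (j = v ∧ numChildren t v = 0) ∨ (j ≠ v ∧ pf t j ∧ ¬ (v.val ≠ 0 ∧ t.val v = j)))).card := by
  rw [numPF_eq, card_filter, Fin.sum_univ_castSucc, card_filter]
  simp [pf_ins, pf_ins_last]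

open Finset in
theorem numPF_A {m : ℕ} (t : IncTree m) (v : Fin m) (h) (h0 : numChildren t v = 0) 
    (hv : v.val ≠ 0 ∧ pf t (t.val v)) : numPitchforks (ins t v h) = numPitchforks t := by
  rw [numPF_ins, numPF_eq]
  have e : (univ.filter (fun j => (j = v ∧ numChildren t v = 0) ∨ (j ≠ v ∧ pf t j ∧ ¬ (v.val ≠ 0 ∧ t.val v = j)))) = insert v ((univ.filter (fun j => pf t j)).erase (t.val v)) := by
    have hnp : ¬ pf t v := fun hp => by have := hp.1; omega
    ext j
    simp only [mem_filter, mem_univ, true_and, mem_insert, mem_erase]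
    by_cases hj : j = v
    · simp [hj, h0]
    · simp only [hj, false_and, false_or, ne_eq, not_false_eq_true, true_and, hv.1]
      grind
  rw [e, card_insert_of_notMem, card_erase_of_mem]
  · have : 0 < (univ.filter (fun j => pf t j)).card := card_pos.2 ⟨t.val v, by simp [hv.2]⟩
    omega
  · simp [hv.2]
  · have hnp : ¬ pf t v := fun hp => by have := hp.1; omega
    simp [hnp]

open Finset in
theorem numPF_B {m : ℕ} (t : IncTree m) (v : Fin m) (h) (h0 : numChildren t v = 0) 
    (hv : ¬ (v.val ≠ 0 ∧ pf t (t.val v))) : numPitchforks (ins t v h) = numPitchforks t + 1 := by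
  rw [numPF_ins, numPF_eq]
  have hnp : ¬ pf t v := fun hp => by have := hp.1; omega
  have e : (univ.filter (fun j => (j = v ∧ numChildren t v = 0) ∨ (j ≠ v ∧ pf t j ∧ ¬ (v.val ≠ 0 ∧ t.val v = j)))) = insert v (univ.filter (fun j => pf t j)) := by
    ext j
    simp only [mem_filter, mem_univ, true_and, mem_insert]
    by_cases hj : j = v
    · simp [hj, h0]
    · simp only [hj, false_and, false_or, ne_eq, not_false_eq_true, true_and]
      grind
  rw [e, card_insert_of_notMem]
  simp [hnp]

open Finset in
theorem numPF_C {m : ℕ} (t : IncTree m) (v : Fin m) (h) (hp : pf t v) :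
    numPitchforks (ins t v h) + 1 = numPitchforks t := by
  rw [numPF_ins, numPF_eq]
  have h1 := hp.1
  have e : (univ.filter (fun j => (j = v ∧ numChildren t v = 0) ∨ (j ≠ v ∧ pf t j ∧ ¬ (v.val ≠ 0 ∧ t.val v = j)))) = (univ.filter (fun j => pf t j)).erase v := by
    ext j
    simp only [mem_filter, mem_univ, true_and, mem_erase]
    have : pf t j → ¬ (v.val ≠ 0 ∧ t.val v = j) := fun hj hv => by
      have := hj.2 v hv.1 hv.2; omega
    have : ¬ numChildren t v = 0 := by omega
    tauto
  rw [e, card_erase_add_one]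
  simp [hp]

open Finset in
theorem numPF_D {m : ℕ} (t : IncTree m) (v : Fin m) (h) (h1 : numChildren t v = 1) (hp : ¬ pf t v) :
    numPitchforks (ins t v h) = numPitchforks t := by
  rw [numPF_ins, numPF_eq]
  congr 1
  ext j
  simp only [mem_filter, mem_univ, true_and]
  have : pf t j → ¬ (v.val ≠ 0 ∧ t.val v = j) := fun hj hv => by
    have := hj.2 v hv.1 hv.2; omega
  have : ¬ numChildren t v = 0 := by omega
  have : j = v → ¬ pf t j := by rintro rfl; exact hp
  tauto

open Finset in
theorem card_A {m : ℕ} (t : IncTree m) :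
    (univ.filter (fun v : Fin m => numChildren t v = 0 ∧ (v.val ≠ 0 ∧ pf t (t.val v)))).card = numPitchforks t := by
  rw [numPF_eq]
  refine card_bij (fun v _ => t.val v) ?_ ?_ ?_
  · intro v hv
    simp at hv ⊢
    exact hv.2.2
  · intro a ha b hb hab
    simp at ha hb
    have h1 := ha.2.2.1
    unfold numChildren at h1
    obtain ⟨x, hx⟩ := card_eq_one.1 h1
    have h2 : a ∈ ({x} : Finset (Fin m)) := by rw [← hx]; simp [ha.2.1]
    have h3 : b ∈ ({x} : Finset (Fin m)) := by
      rw [← hx]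
      simp only [mem_filter, mem_univ, true_and]
      exact ⟨by simpa using hb.2.1, hab.symm⟩
    simp at h2 h3
    rw [h2, h3]
  · intro j hj
    simp at hj
    have h1 := hj.1
    unfold numChildren at h1
    obtain ⟨x, hx⟩ := card_eq_one.1 h1
    have h2 : x ∈ (univ.filter (fun i : Fin m => i.val ≠ 0 ∧ t.val i = j)) := by rw [hx]; simp
    simp only [mem_filter, mem_univ, true_and] at h2
    refine ⟨x, ?_, h2.2⟩
    simp only [mem_filter, mem_univ, true_and]
    exact ⟨hj.2 x h2.1 h2.2, h2.1, by rw [h2.2]; exact hj⟩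

open Finset in
theorem card_AB {m : ℕ} (t : IncTree m) :
    (univ.filter (fun v : Fin m => numChildren t v = 0 ∧ ¬ (v.val ≠ 0 ∧ pf t (t.val v)))).card + numPitchforks t = numLeaves t := by
  have := card_filter_add_card_filter_not (s := univ.filter (fun v : Fin m => numChildren t v = 0))
    (fun v : Fin m => v.val ≠ 0 ∧ pf t (t.val v))
  rw [filter_filter, filter_filter, card_A] at this
  rw [add_comm, numLeaves]
  exact this

open Finset in
theorem sum_nc {m : ℕ} (hm : 1 ≤ m) (t : IncTree m) : ∑ v, numChildren t v + 1 = m := by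
  have h : ∑ v, numChildren t v = (univ.filter (fun i : Fin m => i.val ≠ 0)).card := by
    rw [card_eq_sum_card_fiberwise (f := t.val) (t := univ) (by simp)]
    simp only [filter_filter, numChildren]
  rw [h]
  obtain ⟨n, rfl⟩ : ∃ n, m = n + 1 := ⟨m - 1, by omega⟩
  rw [card_filter, Fin.sum_univ_succ]
  simp

open Finset in
theorem card_D {m : ℕ} (hm : 1 ≤ m) (t : IncTree m) :
    (univ.filter (fun v : Fin m => numChildren t v = 1 ∧ ¬ pf t v)).card + numPitchforks t + 2 * numLeaves t = m + 1 := by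
  have h1 : (univ.filter (fun v : Fin m => numChildren t v = 1 ∧ ¬ pf t v)).card + numPitchforks t
      = (univ.filter (fun v : Fin m => numChildren t v = 1)).card := by
    have : numPitchforks t = (univ.filter (fun v : Fin m => numChildren t v = 1 ∧ pf t v)).card := by
      rw [numPF_eq]
      congr 1
      ext j
      simp only [mem_filter, mem_univ, true_and]
      exact ⟨fun h => ⟨h.1, h⟩, fun h => h.2⟩
    rw [this, ← filter_filter, ← filter_filter, add_comm]
    exact card_filter_add_card_filter_not _
  rw [h1, numLeaves, card_filter, card_filter, mul_sum, ← sum_add_distrib]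
  have h2 := sum_nc hm t
  have h3 : ∑ v : Fin m, ((if numChildren t v = 1 then 1 else 0) + 2 * (if numChildren t v = 0 then 1 else 0)) + ∑ v, numChildren t v = 2 * m := by
    rw [← sum_add_distrib, sum_congr rfl (g := fun _ => 2)]
    · simp [mul_comm]
    · intro v _
      have := t.2.2.2 v
      change numChildren t v ≤ 2 at this
      split_ifs <;> omega
  omega

def insMap (m : ℕ) (p : {p : IncTree m × Fin m // numChildren p.1 p.2 < 2}) : IncTree (m+1) :=
  ins p.1.1 p.1.2 p.2

theorem insMap_inj (m : ℕ) : Function.Injective (insMap m) := by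
  rintro ⟨⟨t, v⟩, h⟩ ⟨⟨s, w⟩, h'⟩ e
  simp only [insMap] at e
  have hv : v = w := by
    have := congrArg (fun t => t.val (Fin.last m)) e
    simpa [ins_val_last, -Fin.castSucc_inj, Fin.castSucc_inj] using this
  have ht : t = s := by
    apply Subtype.ext
    funext i
    have := congrArg (fun t => t.val i.castSucc) e
    simp only [ins_val_castSucc] at this
    exact Fin.castSucc_injective _ this
  subst hv; subst ht; rfl

open Finset in
theorem insMap_surj (m : ℕ) (hm : 1 ≤ m) : Function.Surjective (insMap m) := by
  intro s
  have hlast : (s.val (Fin.last m)).val < m := s.2.2.1 (Fin.last m) (by simp; omega)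
  have hi : ∀ i : Fin m, (s.val i.castSucc).val < m := fun i => by
    by_cases h0 : i.val = 0
    · rw [s.2.1 i.castSucc (by simpa using h0)]; simp
    · have := s.2.2.1 i.castSucc (by simpa using h0)
      have := i.isLt
      simp at *; omega
  let f : Fin m → Fin m := fun i => ⟨_, hi i⟩
  let v : Fin m := ⟨_, hlast⟩
  have hf : ∀ i, (f i).castSucc = s.val i.castSucc := fun i => rfl
  have hvv : v.castSucc = s.val (Fin.last m) := rfl
  have hc : ∀ j : Fin m, (univ.filter (fun i : Fin m => i.val ≠ 0 ∧ f i = j)).card + (if v = j then 1 else 0) ≤ 2 := by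
    intro j
    refine le_trans (le_of_eq ?_) (s.2.2.2 j.castSucc)
    have hm' : m ≠ 0 := by omega
    rw [card_filter, card_filter, Fin.sum_univ_castSucc]
    simp only [← hf, ← hvv, Fin.castSucc_inj]
    simp [hm']
  let t : IncTree m := ⟨f, fun i h0 => by
      apply Fin.castSucc_injective
      rw [hf, s.2.1 i.castSucc (by simpa using h0)], fun i h0 => s.2.2.1 i.castSucc (by simpa using h0),
      fun j => le_trans (Nat.le_add_right _ _) (hc j)⟩
  refine ⟨⟨(t, v), ?_⟩, ?_⟩
  · have := hc v
    simp only [if_true] at this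
    change numChildren t v + 1 ≤ 2 at this
    change numChildren t v < 2
    omega
  · apply Subtype.ext
    funext i
    refine Fin.lastCases ?_ (fun i => ?_) i
    · simp only [insMap, ins_val_last]; rfl
    · simp only [insMap, ins_val_castSucc]; rfl

/-- contribution of `(t, v)`. -/
def contrib {m : ℕ} (o r : ℤ) (t : IncTree m) (v : Fin m) : ℤ :=
  (if numChildren t v = 0 ∧ (v.val ≠ 0 ∧ pf t (t.val v)) then
    (if (numLeaves t : ℤ) = o ∧ (numPitchforks t : ℤ) = r then 1 else 0) else 0)
  + (if numChildren t v = 0 ∧ ¬ (v.val ≠ 0 ∧ pf t (t.val v)) then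
    (if (numLeaves t : ℤ) = o ∧ (numPitchforks t : ℤ) = r - 1 then 1 else 0) else 0)
  + (if pf t v then
    (if (numLeaves t : ℤ) = o - 1 ∧ (numPitchforks t : ℤ) = r + 1 then 1 else 0) else 0)
  + (if numChildren t v = 1 ∧ ¬ pf t v then
    (if (numLeaves t : ℤ) = o - 1 ∧ (numPitchforks t : ℤ) = r then 1 else 0) else 0)

theorem contrib_ge {m : ℕ} (o r : ℤ) (t : IncTree m) (v : Fin m) (h : ¬ numChildren t v < 2) :
    contrib o r t v = 0 := by
  have h0 : ¬ numChildren t v = 0 := by omega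
  have h1 : ¬ numChildren t v = 1 := by omega
  have h2 : ¬ pf t v := fun h => h1 h.1
  simp [contrib, h0, h1, h2]

theorem contrib_lt {m : ℕ} (o r : ℤ) (t : IncTree m) (v : Fin m) (h : numChildren t v < 2) :
    (if ((numLeaves (ins t v h) : ℤ) = o ∧ (numPitchforks (ins t v h) : ℤ) = r) then 1 else 0) = contrib o r t v := by
  have hl := leaves_ins t v h
  unfold contrib
  by_cases h0 : numChildren t v = 0
  · have h1 : ¬ numChildren t v = 1 := by omega
    have h2 : ¬ pf t v := fun h => h1 h.1
    rw [if_pos h0] at hl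
    by_cases hA : v.val ≠ 0 ∧ pf t (t.val v)
    · have hp := numPF_A t v h h0 hA
      have c0 : (numChildren t v = 0 ∧ (v.val ≠ 0 ∧ pf t (t.val v))) := by tauto
      have c1 : ¬ (numChildren t v = 0 ∧ ¬ (v.val ≠ 0 ∧ pf t (t.val v))) := by tauto
      have c2 : ¬ (pf t v) := by tauto
      have c3 : ¬ (numChildren t v = 1 ∧ ¬ pf t v) := by tauto
      have key : ((numLeaves (ins t v h) : ℤ) = o ∧ (numPitchforks (ins t v h) : ℤ) = r) ↔ ((numLeaves t : ℤ) = o ∧ (numPitchforks t : ℤ) = r) := by omega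
      rw [if_congr key rfl rfl, if_pos c0, if_neg c1, if_neg c2, if_neg c3]
      simp only [add_zero, zero_add]
    · have hp := numPF_B t v h h0 hA
      have c0 : ¬ (numChildren t v = 0 ∧ (v.val ≠ 0 ∧ pf t (t.val v))) := by tauto
      have c1 : (numChildren t v = 0 ∧ ¬ (v.val ≠ 0 ∧ pf t (t.val v))) := by tauto
      have c2 : ¬ (pf t v) := by tauto
      have c3 : ¬ (numChildren t v = 1 ∧ ¬ pf t v) := by tauto
      have key : ((numLeaves (ins t v h) : ℤ) = o ∧ (numPitchforks (ins t v h) : ℤ) = r) ↔ ((numLeaves t : ℤ) = o ∧ (numPitchforks t : ℤ) = r - 1) := by omega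
      rw [if_congr key rfl rfl, if_neg c0, if_pos c1, if_neg c2, if_neg c3]
      simp only [add_zero, zero_add]
  · have h1 : numChildren t v = 1 := by omega
    rw [if_neg h0] at hl
    by_cases h2 : pf t v
    · have hp := numPF_C t v h h2
      have c0 : ¬ (numChildren t v = 0 ∧ (v.val ≠ 0 ∧ pf t (t.val v))) := by tauto
      have c1 : ¬ (numChildren t v = 0 ∧ ¬ (v.val ≠ 0 ∧ pf t (t.val v))) := by tauto
      have c2 : (pf t v) := by tauto
      have c3 : ¬ (numChildren t v = 1 ∧ ¬ pf t v) := by tauto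
      have key : ((numLeaves (ins t v h) : ℤ) = o ∧ (numPitchforks (ins t v h) : ℤ) = r) ↔ ((numLeaves t : ℤ) = o - 1 ∧ (numPitchforks t : ℤ) = r + 1) := by omega
      rw [if_congr key rfl rfl, if_neg c0, if_neg c1, if_pos c2, if_neg c3]
      simp only [add_zero, zero_add]
    · have hp := numPF_D t v h h1 h2
      have c0 : ¬ (numChildren t v = 0 ∧ (v.val ≠ 0 ∧ pf t (t.val v))) := by tauto
      have c1 : ¬ (numChildren t v = 0 ∧ ¬ (v.val ≠ 0 ∧ pf t (t.val v))) := by tauto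
      have c2 : ¬ (pf t v) := by tauto
      have c3 : (numChildren t v = 1 ∧ ¬ pf t v) := by tauto
      have key : ((numLeaves (ins t v h) : ℤ) = o ∧ (numPitchforks (ins t v h) : ℤ) = r) ↔ ((numLeaves t : ℤ) = o - 1 ∧ (numPitchforks t : ℤ) = r) := by omega
      rw [if_congr key rfl rfl, if_neg c0, if_neg c1, if_neg c2, if_pos c3]
      simp only [add_zero, zero_add]

theorem sum_ite_aux {m : ℕ} (P : Fin m → Prop) [DecidablePred P] (c : ℤ) :
    ∑ v, (if P v then c else 0) = (Finset.univ.filter P).card * c := by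
  rw [← Finset.sum_filter, Finset.sum_const, nsmul_eq_mul]

open Finset in
theorem count_eq_sum {m : ℕ} (o r : ℤ) : (countByLeavesPitchforks m o r : ℤ) =
    ∑ t : IncTree m, if (numLeaves t : ℤ) = o ∧ (numPitchforks t : ℤ) = r then 1 else 0 := by
  rw [countByLeavesPitchforks, card_filter]
  push_cast
  rfl

open Finset in
theorem sum_contrib {m : ℕ} (hm : 1 ≤ m) (o r : ℤ) (t : IncTree m) :
    ∑ v, contrib o r t v =
      r * (if (numLeaves t : ℤ) = o ∧ (numPitchforks t : ℤ) = r then 1 else 0)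
      + (o - r + 1) * (if (numLeaves t : ℤ) = o ∧ (numPitchforks t : ℤ) = r - 1 then 1 else 0)
      + (r + 1) * (if (numLeaves t : ℤ) = o - 1 ∧ (numPitchforks t : ℤ) = r + 1 then 1 else 0)
      + ((m : ℤ) - 2 * o + 3 - r) * (if (numLeaves t : ℤ) = o - 1 ∧ (numPitchforks t : ℤ) = r then 1 else 0) := by
  have hA := card_A t
  have hB := card_AB t
  have hC := numPF_eq t
  have hD := card_D hm t
  unfold contrib
  simp only [sum_add_distrib]
  rw [sum_ite_aux, sum_ite_aux, sum_ite_aux, sum_ite_aux]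
  rw [hA, ← hC]
  congr 1
  · congr 1
    · congr 1
      · split_ifs with h
        · rw [h.2]
        · simp
      · split_ifs with h
        · simp only [mul_one]; omega
        · simp
    · split_ifs with h
      · rw [h.2]
      · simp
  · split_ifs with h
    · simp only [mul_one]; omega
    · simp

/-- The succession rule for cherries and pitchforks:
`b(m+1,o,r) = r·b(m,o,r) + (o−r+1)·b(m,o,r−1) + (r+1)·b(m,o−1,r+1)
             + (m−2o+3−r)·b(m,o−1,r)` for `m ≥ 1`, `o ≥ 1`, `r ≥ 0`. -/
theorem countByLeavesPitchforks_recursion (m : ℕ) (hm : 1 ≤ m)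
    (o : ℤ) (ho : 1 ≤ o) (r : ℤ) (hr : 0 ≤ r) :
    (countByLeavesPitchforks (m + 1) o r : ℤ) =
      r * countByLeavesPitchforks m o r
        + (o - r + 1) * countByLeavesPitchforks m o (r - 1)
        + (r + 1) * countByLeavesPitchforks m (o - 1) (r + 1)
        + ((m : ℤ) - 2 * o + 3 - r) * countByLeavesPitchforks m (o - 1) r := by
  rw [count_eq_sum, count_eq_sum, count_eq_sum, count_eq_sum, count_eq_sum]
  simp only [Finset.mul_sum]
  rw [← Finset.sum_add_distrib, ← Finset.sum_add_distrib, ← Finset.sum_add_distrib]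
  simp only [← sum_contrib hm]
  rw [← Function.Bijective.sum_comp ⟨insMap_inj m, insMap_surj m hm⟩]
  refine (Finset.sum_congr rfl (g := fun p : {p : IncTree m × Fin m // numChildren p.1 p.2 < 2} => contrib o r p.1.1 p.1.2)
    (fun p _ => contrib_lt o r p.1.1 p.1.2 p.2)).trans ?_
  rw [← Finset.sum_product' (s := Finset.univ) (t := Finset.univ) (f := fun t v => contrib o r t v),
    Finset.univ_product_univ]
  rw [← Finset.sum_filter_add_sum_filter_not Finset.univ
    (fun p : IncTree m × Fin m => numChildren p.1 p.2 < 2)]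
  rw [Finset.sum_eq_zero (s := Finset.univ.filter
    (fun p : IncTree m × Fin m => ¬ numChildren p.1 p.2 < 2)), add_zero]
  · rw [Finset.sum_subtype (p := fun p : IncTree m × Fin m => numChildren p.1 p.2 < 2)]
    simp
  · intro p hp
    exact contrib_ge o r p.1 p.2 (by simpa using hp)
end

section
/- For every integer m ≥ 2, Σ_{t ∈ I_m} o(t)·2^{m − o(t)} = (m + 1)·m!/3. Equivalently, the expected number of cherries of a ranked tree of size n > 2 generated by the coalescent process is n/3. -/
/-- Attach a new last vertex to the vertex `j`. -/
def extFun {n : ℕ} (f : Fin (n+1) → Fin (n+1)) (j : Fin (n+1)) : Fin (n+2) → Fin (n+2) :=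
  Fin.lastCases j.castSucc (fun i => (f i).castSucc)

def cnt {m : ℕ} (f : Fin m → Fin m) (j : Fin m) : ℕ :=
  (Finset.univ.filter (fun i : Fin m => i.val ≠ 0 ∧ f i = j)).card

theorem cnt_eq_sum {m : ℕ} (f : Fin m → Fin m) (j : Fin m) :
    cnt f j = ∑ i : Fin m, if i.val ≠ 0 ∧ f i = j then 1 else 0 := by
  rw [cnt, Finset.card_filter]

theorem cnt_ext_castSucc {n : ℕ} (f : Fin (n+1) → Fin (n+1)) (j k : Fin (n+1)) :
    cnt (extFun f j) k.castSucc = cnt f k + if k = j then 1 else 0 := by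
  rw [cnt_eq_sum, cnt_eq_sum, Fin.sum_univ_castSucc]
  simp [extFun, eq_comm]

theorem cnt_ext_last {n : ℕ} (f : Fin (n+1) → Fin (n+1)) (j : Fin (n+1)) :
    cnt (extFun f j) (Fin.last _) = 0 := by
  rw [cnt_eq_sum, Fin.sum_univ_castSucc]
  simp [extFun, (Fin.castSucc_lt_last _).ne]

def extTree {n : ℕ} (p : Σ t : IncTree (n+1), {j : Fin (n+1) // numChildren t j ≤ 1}) :
    IncTree (n+2) :=
  ⟨extFun p.1.val p.2.val, by
    obtain ⟨⟨f, h0, h1, h2⟩, j, hj⟩ := p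
    refine ⟨?_, ?_, ?_⟩
    · intro i
      induction i using Fin.lastCases with
      | last => simp
      | cast i => intro h; simp [extFun, h0 i (by simpa using h)]
    · intro i
      induction i using Fin.lastCases with
      | last => simp [extFun]; omega
      | cast i => intro h; simpa [extFun] using h1 i (by simpa using h)
    · intro k
      change cnt _ k ≤ 2
      induction k using Fin.lastCases with
      | last => rw [cnt_ext_last]; omega
      | cast k =>
        rw [cnt_ext_castSucc]
        have h3 : cnt f k ≤ 2 := h2 k
        have h4 : cnt f j ≤ 1 := hj
        dsimp only
        split_ifs with h
        · subst h; omega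
        · omega⟩

theorem extTree_bij {n : ℕ} : Function.Bijective (extTree (n := n)) := by
  constructor
  · rintro ⟨⟨f, hf⟩, j, hj⟩ ⟨⟨g, hg⟩, k, hk⟩ h
    have h' : extFun f j = extFun g k := congrArg Subtype.val h
    have e1 : f = g := by
      funext i
      have := congrFun h' i.castSucc
      simpa [extFun] using this
    have e2 : j = k := by
      have := congrFun h' (Fin.last _)
      simpa [extFun] using this
    subst e1; subst e2; rfl
  · rintro ⟨g, h0, h1, h2⟩
    have hlt : ∀ i : Fin (n+1), (g i.castSucc).val < n+1 := by
      intro i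
      by_cases hi : i.val = 0
      · rw [h0 _ (by simpa using hi)]; simp; omega
      · have := h1 i.castSucc (by simpa using hi)
        simp at this; omega
    have hl : (g (Fin.last _)).val < n+1 := by
      have := h1 (Fin.last _) (by simp)
      simpa using this
    let f : Fin (n+1) → Fin (n+1) := fun i => ⟨(g i.castSucc).val, hlt i⟩
    let j : Fin (n+1) := ⟨(g (Fin.last _)).val, hl⟩
    have hg : extFun f j = g := by
      funext i
      induction i using Fin.lastCases with
      | last => simp [extFun, j]
      | cast i => simp [extFun, f]
    have hc : ∀ k, cnt f k + (if k = j then 1 else 0) ≤ 2 := by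
      intro k
      rw [← cnt_ext_castSucc, hg]; exact h2 _
    have hf : (∀ i, i.val = 0 → f i = i) ∧ (∀ i, i.val ≠ 0 → (f i).val < i.val) ∧
        ∀ k, cnt f k ≤ 2 := by
      refine ⟨?_, ?_, fun k => le_trans (Nat.le_add_right _ _) (hc k)⟩
      · intro i hi
        apply Fin.ext
        simp [f, h0 i.castSucc (by simpa using hi)]
      · intro i hi
        simpa [f] using h1 i.castSucc (by simpa using hi)
    have hj : cnt f j ≤ 1 := by
      have := hc j
      simp at this; omega
    exact ⟨⟨⟨f, hf⟩, ⟨j, hj⟩⟩, Subtype.ext hg⟩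

theorem numLeaves_eq {m : ℕ} (t : IncTree m) :
    numLeaves t = ∑ j, if cnt t.val j = 0 then 1 else 0 := by
  rw [numLeaves, Finset.card_filter]; rfl

theorem numLeaves_le {m : ℕ} (t : IncTree m) : numLeaves t ≤ m := by
  have := Finset.card_filter_le (Finset.univ : Finset (Fin m)) (fun j => numChildren t j = 0)
  simpa [numLeaves] using this

theorem numLeaves_ext {n : ℕ} (t : IncTree (n+1)) (j : {j : Fin (n+1) // numChildren t j ≤ 1}) :
    numLeaves (extTree ⟨t, j⟩) = if cnt t.val j.val = 0 then numLeaves t else numLeaves t + 1 := by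
  rw [numLeaves_eq, Fin.sum_univ_castSucc]
  have e : (extTree ⟨t, j⟩).val = extFun t.val j.val := rfl
  rw [e, cnt_ext_last]
  simp only [cnt_ext_castSucc, if_true]
  have : numLeaves t = (∑ k, if cnt t.val k + (if k = j.val then 1 else 0) = 0 then 1 else 0)
      + if cnt t.val j.val = 0 then 1 else 0 := by
    rw [numLeaves_eq]
    have : (if cnt t.val j.val = 0 then 1 else 0) =
      ∑ k, if k = j.val then (if cnt t.val j.val = 0 then 1 else 0) else 0 := by simp
    rw [this, ← Finset.sum_add_distrib]
    apply Finset.sum_congr rfl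
    intro k _
    by_cases hk : k = j.val
    · subst hk; simp
    · simp [hk]
  rw [this]
  split_ifs <;> omega

theorem sum_cnt {n : ℕ} (f : Fin (n+1) → Fin (n+1)) : ∑ j, cnt f j = n := by
  simp only [cnt_eq_sum]
  rw [Finset.sum_comm, Fin.sum_univ_succ]
  simp

theorem unary {n : ℕ} (t : IncTree (n+1)) :
    (∑ j, if cnt t.val j = 1 then (1:ℚ) else 0) = n + 2 - 2 * numLeaves t := by
  have h := sum_cnt t.val
  have : ∀ j, (if cnt t.val j = 1 then (1:ℚ) else 0) =
      2 - 2 * (if cnt t.val j = 0 then (1:ℚ) else 0) - cnt t.val j := by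
    intro j
    have h2 : cnt t.val j ≤ 2 := t.2.2.2 j
    interval_cases cnt t.val j <;> norm_num
  simp only [this, Finset.sum_sub_distrib, ← Finset.mul_sum]
  have h' : (∑ j, (cnt t.val j : ℚ)) = n := by exact_mod_cast h
  rw [h', numLeaves_eq]
  push_cast
  simp
  ring

theorem sum_rec {n : ℕ} (F : ℕ → ℚ) :
    ∑ t : IncTree (n+2), F (numLeaves t) =
    ∑ t : IncTree (n+1), (numLeaves t * F (numLeaves t) +
      (n + 2 - 2 * numLeaves t) * F (numLeaves t + 1)) := by
  rw [← (Equiv.ofBijective _ (extTree_bij (n := n))).sum_comp, Fintype.sum_sigma]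
  apply Finset.sum_congr rfl
  intro t _
  simp only [Equiv.ofBijective_apply, numLeaves_ext]
  rw [← unary t]
  have hL : (numLeaves t : ℚ) = ∑ j, if cnt t.val j = 0 then (1:ℚ) else 0 := by
    rw [numLeaves_eq]; push_cast; rfl
  conv_rhs => rw [hL]
  rw [Finset.sum_mul, Finset.sum_mul, ← Finset.sum_add_distrib]
  rw [← Finset.sum_subtype (Finset.univ.filter fun j => numChildren t j ≤ 1) (by simp)
    (fun j => F (if cnt t.val j = 0 then numLeaves t else numLeaves t + 1)), Finset.sum_filter]
  apply Finset.sum_congr rfl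
  intro j _
  change (if cnt t.val j ≤ 1 then _ else _) = _
  have h2 : cnt t.val j ≤ 2 := t.2.2.2 j
  interval_cases cnt t.val j <;> simp

theorem sum_one (G : ℕ → ℚ) : ∑ t : IncTree 1, G (numLeaves t) = G 1 := by
  have h : ∀ t : IncTree 1, numLeaves t = 1 := by
    intro t
    rw [numLeaves_eq]
    simp [cnt_eq_sum]
  have hc : Fintype.card (IncTree 1) = 1 := by decide
  simp [h, hc]

theorem weight_sum (n : ℕ) :
    ∑ t : IncTree (n+1), (2:ℚ) ^ (n + 1 - numLeaves t) = (n+1).factorial := by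
  induction n with
  | zero => rw [sum_one (fun L => (2:ℚ) ^ (0 + 1 - L))]; simp
  | succ n ih =>
    rw [sum_rec (fun L => (2:ℚ) ^ (n + 1 + 1 - L)), Nat.factorial_succ]
    push_cast
    rw [← ih, Finset.mul_sum]
    apply Finset.sum_congr rfl
    intro t _
    have := numLeaves_le t
    rw [show n + 1 + 1 - numLeaves t = (n + 1 - numLeaves t) + 1 by omega]
    ring

theorem leaf_rec (n : ℕ) :
    ∑ t : IncTree (n+2), (numLeaves t : ℚ) * 2 ^ (n + 2 - numLeaves t) =
    n * (∑ t : IncTree (n+1), (numLeaves t : ℚ) * 2 ^ (n + 1 - numLeaves t)) +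
      (n + 2).factorial := by
  rw [sum_rec (fun L => (L:ℚ) * (2:ℚ) ^ (n + 2 - L)), Nat.factorial_succ]
  push_cast
  rw [← weight_sum, Finset.mul_sum, Finset.mul_sum, ← Finset.sum_add_distrib]
  apply Finset.sum_congr rfl
  intro t _
  have := numLeaves_le t
  rw [show n + 2 - numLeaves t = (n + 1 - numLeaves t) + 1 by omega]
  ring

theorem leaf_sum (n : ℕ) :
    ∑ t : IncTree (n+2), (numLeaves t : ℚ) * 2 ^ (n + 2 - numLeaves t) =
      ((n : ℚ) + 3) * (n+2).factorial / 3 := by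
  induction n with
  | zero => rw [leaf_rec]; norm_num [Nat.factorial]
  | succ n ih =>
    rw [leaf_rec, ih, Nat.factorial_succ (n+2)]
    push_cast
    ring

/-- `Σ_{t ∈ I_m} o(t)·2^{m − o(t)} = (m + 1)·m!/3` for `m ≥ 2`: the expected
number of cherries of a coalescent-generated ranked tree of size `n = m + 1 > 2`
is `n/3`. -/
theorem expected_cherries (m : ℕ) (hm : 2 ≤ m) :
    ∑ t : IncTree m, (numLeaves t : ℚ) * 2 ^ (m - numLeaves t) =
      ((m : ℚ) + 1) * (Nat.factorial m) / 3 := by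
  obtain ⟨n, rfl⟩ : ∃ n, m = n + 2 := ⟨m - 2, by omega⟩
  rw [leaf_sum]
  push_cast
  ring
end
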